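/- arXiv:2104.11360 — 4 statements merged into one kernel-verified Lean document; each statement's English description precedes it below -/
import Mathlib

section
/- Principle of nil causality (multivariate case). Let ρ : ℝ^d → ℝ (d ≥ 3) be a probability density with ρ1 > 0 almost everywhere, and suppose F1 : ℝ^d → ℝ and g11 : ℝ^d → ℝ do not depend on the coordinate x2, i.e., F1(x) = F̃1(x1,x3,…,xd) and g11(x) = g̃11(x1,x3,…,xd). Assume: for almost every (x3,…,xd), the map x1 ↦ F̃1 ρ_{∖2} is differentiable with integrable derivative and tends to 0 as x1 → ±∞; the map x1 ↦ g̃11 ρ_{∖2} is twice differentiable, it and its first x1-derivative tend to 0 as x1 → ±∞, and its second x1-derivative is integrable; and both defining integrals of T_{2→1} converge absolutely. Then the information flow from component 2 to component 1 vanishes: T_{2→1} = 0. -/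
open MeasureTheory Real Filter Topology

lemma aux_zero {m : ℕ} (c : ℝ → ℝ → ℝ) (h : ℝ → (Fin m → ℝ) → ℝ)
    (hc : ∀ᵐ x1 : ℝ, ∫ x2 : ℝ, c x1 x2 = 1)
    (hi : Integrable (fun q : ℝ × ℝ × (Fin m → ℝ) => c q.1 q.2.1 * h q.1 q.2.2))
    (hh : ∀ᵐ y : Fin m → ℝ, ∫ x1 : ℝ, h x1 y = 0) :
    ∫ q : ℝ × ℝ × (Fin m → ℝ), c q.1 q.2.1 * h q.1 q.2.2 = 0 := by
  let e : ((Fin m → ℝ) × ℝ) × ℝ ≃ᵐ ℝ × ℝ × (Fin m → ℝ) :=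
    (MeasurableEquiv.prodAssoc.trans MeasurableEquiv.prodComm).trans MeasurableEquiv.prodAssoc
  have he : MeasurePreserving e volume volume := by
    have h1 : MeasurePreserving
        (MeasurableEquiv.prodAssoc : ((Fin m → ℝ) × ℝ) × ℝ ≃ᵐ _) volume volume :=
      measurePreserving_prodAssoc volume volume volume
    have h2 : MeasurePreserving
        (MeasurableEquiv.prodComm : (Fin m → ℝ) × ℝ × ℝ ≃ᵐ _) volume volume :=
      Measure.measurePreserving_swap
    have h3 : MeasurePreserving
        (MeasurableEquiv.prodAssoc : (ℝ × ℝ) × (Fin m → ℝ) ≃ᵐ _) volume volume :=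
      measurePreserving_prodAssoc volume volume volume
    exact h3.comp (h2.comp h1)
  rw [← he.integral_comp e.measurableEmbedding]
  have hi' := (he.integrable_comp_emb e.measurableEmbedding).2 hi
  have hi2 : Integrable (fun q : ((Fin m → ℝ) × ℝ) × ℝ => c q.1.2 q.2 * h q.1.2 q.1.1)
      ((volume : Measure ((Fin m → ℝ) × ℝ)).prod volume) := hi'
  change ∫ q : ((Fin m → ℝ) × ℝ) × ℝ, c q.1.2 q.2 * h q.1.2 q.1.1
    ∂((volume : Measure ((Fin m → ℝ) × ℝ)).prod volume) = 0
  have hae : (fun p : (Fin m → ℝ) × ℝ => ∫ x2 : ℝ, c p.2 x2 * h p.2 p.1) =ᵐ[volume]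
      fun p => h p.2 p.1 := by
    have := (Measure.quasiMeasurePreserving_snd
      (μ := (volume : Measure (Fin m → ℝ))) (ν := (volume : Measure ℝ))).ae hc
    filter_upwards [this] with p hp
    rw [integral_mul_const, hp, one_mul]
  rw [integral_prod _ hi2, integral_congr_ae hae]
  have hi3 : Integrable (fun p : (Fin m → ℝ) × ℝ => h p.2 p.1)
      ((volume : Measure (Fin m → ℝ)).prod volume) := hi2.integral_prod_left.congr hae
  change ∫ p : (Fin m → ℝ) × ℝ, h p.2 p.1 ∂((volume : Measure (Fin m → ℝ)).prod volume) = 0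
  rw [integral_prod _ hi3]
  exact integral_eq_zero_of_ae hh

/-- **Principle of nil causality, multivariate case.**
If neither `F1` nor `g11` depends on the coordinate `x2`, then (under decay,
differentiability and integrability conditions) the information flow
`T_{2→1} = −∫ ρ_{2|1} ∂(F1 ρ_{∖2})/∂x1 dx + (1/2) ∫ ρ_{2|1} ∂²(g11 ρ_{∖2})/∂x1² dx`
vanishes.  Here `d = m + 2 ≥ 3`. -/
theorem stmt_1 (m : ℕ) (hm : 1 ≤ m)
    (ρ F1 g11 : ℝ → ℝ → (Fin m → ℝ) → ℝ)
    -- ρ is a probability density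
    (hρ_nonneg : ∀ x1 x2 y, 0 ≤ ρ x1 x2 y)
    (hρ_int : Integrable (fun p : ℝ × ℝ × (Fin m → ℝ) => ρ p.1 p.2.1 p.2.2))
    (hρ_one : ∫ p : ℝ × ℝ × (Fin m → ℝ), ρ p.1 p.2.1 p.2.2 = 1)
    -- the marginals
    (ρ1 : ℝ → ℝ) (hρ1 : ∀ x1, ρ1 x1 = ∫ q : ℝ × (Fin m → ℝ), ρ x1 q.1 q.2)
    (ρm2 : ℝ → (Fin m → ℝ) → ℝ) (hρm2 : ∀ x1 y, ρm2 x1 y = ∫ x2 : ℝ, ρ x1 x2 y)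
    (ρ12 : ℝ → ℝ → ℝ) (hρ12 : ∀ x1 x2, ρ12 x1 x2 = ∫ y : Fin m → ℝ, ρ x1 x2 y)
    -- ρ1 > 0 almost everywhere
    (hρ1pos : ∀ᵐ x1 : ℝ, 0 < ρ1 x1)
    -- F1 and g11 do not depend on x2
    (F1t g11t : ℝ → (Fin m → ℝ) → ℝ)
    (hF1 : ∀ x1 x2 y, F1 x1 x2 y = F1t x1 y)
    (hg11 : ∀ x1 x2 y, g11 x1 x2 y = g11t x1 y)
    -- for a.e. (x3,…,xd): x1 ↦ F̃1 ρ_{∖2} is differentiable with integrable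
    -- derivative and tends to 0 as x1 → ±∞
    (hF : ∀ᵐ y : Fin m → ℝ,
        Differentiable ℝ (fun x1 => F1t x1 y * ρm2 x1 y) ∧
        Integrable (deriv (fun x1 => F1t x1 y * ρm2 x1 y)) ∧
        Tendsto (fun x1 => F1t x1 y * ρm2 x1 y) atTop (𝓝 0) ∧
        Tendsto (fun x1 => F1t x1 y * ρm2 x1 y) atBot (𝓝 0))
    -- for a.e. (x3,…,xd): x1 ↦ g̃11 ρ_{∖2} is twice differentiable, it and its
    -- first derivative tend to 0 at ±∞, and its second derivative is integrable
    (hg : ∀ᵐ y : Fin m → ℝ,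
        Differentiable ℝ (fun x1 => g11t x1 y * ρm2 x1 y) ∧
        Differentiable ℝ (deriv (fun x1 => g11t x1 y * ρm2 x1 y)) ∧
        Tendsto (fun x1 => g11t x1 y * ρm2 x1 y) atTop (𝓝 0) ∧
        Tendsto (fun x1 => g11t x1 y * ρm2 x1 y) atBot (𝓝 0) ∧
        Tendsto (deriv (fun x1 => g11t x1 y * ρm2 x1 y)) atTop (𝓝 0) ∧
        Tendsto (deriv (fun x1 => g11t x1 y * ρm2 x1 y)) atBot (𝓝 0) ∧
        Integrable (deriv (deriv (fun x1 => g11t x1 y * ρm2 x1 y))))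
    -- both defining integrals of T_{2→1} converge absolutely
    (habs1 : Integrable (fun q : ℝ × ℝ × (Fin m → ℝ) =>
        ρ12 q.1 q.2.1 / ρ1 q.1 * deriv (fun t => F1 t q.2.1 q.2.2 * ρm2 t q.2.2) q.1))
    (habs2 : Integrable (fun q : ℝ × ℝ × (Fin m → ℝ) =>
        ρ12 q.1 q.2.1 / ρ1 q.1 *
          deriv (deriv (fun t => g11 t q.2.1 q.2.2 * ρm2 t q.2.2)) q.1)) :
    -(∫ q : ℝ × ℝ × (Fin m → ℝ),
        ρ12 q.1 q.2.1 / ρ1 q.1 * deriv (fun t => F1 t q.2.1 q.2.2 * ρm2 t q.2.2) q.1)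
    + (1/2) * ∫ q : ℝ × ℝ × (Fin m → ℝ),
        ρ12 q.1 q.2.1 / ρ1 q.1 *
          deriv (deriv (fun t => g11 t q.2.1 q.2.2 * ρm2 t q.2.2)) q.1
    = 0 := by
  have hc : ∀ᵐ x1 : ℝ, ∫ x2 : ℝ, ρ12 x1 x2 / ρ1 x1 = 1 := by
    have hs : ∀ᵐ x1 : ℝ, Integrable (fun q : ℝ × (Fin m → ℝ) => ρ x1 q.1 q.2)
      ((volume : Measure ℝ).prod volume) := Integrable.prod_right_ae hρ_int
    filter_upwards [hs, hρ1pos] with x1 h1 h2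
    rw [integral_div, div_eq_one_iff_eq h2.ne', hρ1]
    simp only [hρ12]
    exact (integral_prod _ h1).symm
  simp only [hF1] at habs1 ⊢
  simp only [hg11] at habs2 ⊢
  rw [aux_zero (fun x1 x2 => ρ12 x1 x2 / ρ1 x1)
      (fun x1 y => deriv (fun t => F1t t y * ρm2 t y) x1) hc habs1,
    aux_zero (fun x1 x2 => ρ12 x1 x2 / ρ1 x1)
      (fun x1 y => deriv (deriv (fun t => g11t t y * ρm2 t y)) x1) hc habs2]
  · simp
  · filter_upwards [hg] with y ⟨_, h2, _, _, h5, h6, h7⟩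
    simpa using integral_of_hasDerivAt_of_tendsto (fun x => (h2 x).hasDerivAt) h7 h6 h5
  · filter_upwards [hF] with y ⟨h1, h2, h3, h4⟩
    simpa using integral_of_hasDerivAt_of_tendsto (fun x => (h1 x).hasDerivAt) h2 h4 h3
end

section
/- Principle of nil causality (bivariate case). Let ρ : ℝ² → ℝ be a probability density with marginal ρ1(x1) = ∫_ℝ ρ(x1,x2) dx2 positive almost everywhere, and conditional density ρ_{2|1}(x2|x1) = ρ(x1,x2)/ρ1(x1). Suppose F1 : ℝ² → ℝ and g11 : ℝ² → ℝ depend only on x1, i.e., F1(x1,x2) = F̃1(x1) and g11(x1,x2) = g̃11(x1). Assume x1 ↦ F̃1(x1)ρ1(x1) is differentiable with integrable derivative and tends to 0 as x1 → ±∞; x1 ↦ g̃11(x1)ρ1(x1) is twice differentiable, it and its first derivative tend to 0 as x1 → ±∞, and its second derivative is integrable; and both defining integrals of T_{2→1} converge absolutely. Then T_{2→1} = −∫_{ℝ²} ρ_{2|1}(x2|x1) ∂(F1 ρ1)/∂x1 dx1 dx2 + (1/2) ∫_{ℝ²} ρ_{2|1}(x2|x1) ∂²(g11 ρ1)/∂x1²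 dx1 dx2 = 0. -/
open MeasureTheory Real Filter Topology

theorem nil_aux (ρ : ℝ → ℝ → ℝ) (ρ1 : ℝ → ℝ) (hρ1 : ∀ x1, ρ1 x1 = ∫ x2 : ℝ, ρ x1 x2)
    (hρ1pos : ∀ᵐ x1 : ℝ, 0 < ρ1 x1) (f : ℝ → ℝ) (hf : Differentiable ℝ f)
    (hint : Integrable (deriv f)) (htop : Tendsto f atTop (𝓝 0)) (hbot : Tendsto f atBot (𝓝 0))
    (habs : Integrable (fun p : ℝ × ℝ => ρ p.1 p.2 / ρ1 p.1 * deriv f p.1)) :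
    ∫ p : ℝ × ℝ, ρ p.1 p.2 / ρ1 p.1 * deriv f p.1 = 0 := by
  have h0 : ∫ x, deriv f x = 0 := by
    have := integral_of_hasDerivAt_of_tendsto (fun x => (hf x).hasDerivAt) hint hbot htop
    simpa using this
  rw [Measure.volume_eq_prod] at habs ⊢
  rw [integral_prod _ habs, ← h0]
  apply integral_congr_ae
  filter_upwards [hρ1pos] with x hx
  simp only [integral_mul_const, integral_div, ← hρ1]
  rw [div_self hx.ne', one_mul]

/-- **Principle of nil causality, bivariate case.**
For a probability density `ρ` on `ℝ²` with marginal `ρ1` positive a.e. and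
conditional density `ρ_{2|1}(x2|x1) = ρ(x1,x2)/ρ1(x1)`, if `F1` and `g11` depend
only on `x1`, then (under decay, differentiability and integrability conditions)
`T_{2→1} = −∫ ρ_{2|1} ∂(F1 ρ1)/∂x1 + (1/2) ∫ ρ_{2|1} ∂²(g11 ρ1)/∂x1² = 0`. -/
theorem stmt_2 (ρ F1 g11 : ℝ → ℝ → ℝ)
    -- ρ is a probability density on ℝ²
    (hρ_nonneg : ∀ x1 x2, 0 ≤ ρ x1 x2)
    (hρ_int : Integrable (fun p : ℝ × ℝ => ρ p.1 p.2))
    (hρ_one : ∫ p : ℝ × ℝ, ρ p.1 p.2 = 1)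
    -- the marginal of the first coordinate, positive almost everywhere
    (ρ1 : ℝ → ℝ) (hρ1 : ∀ x1, ρ1 x1 = ∫ x2 : ℝ, ρ x1 x2)
    (hρ1pos : ∀ᵐ x1 : ℝ, 0 < ρ1 x1)
    -- F1 and g11 depend only on x1
    (F1t g11t : ℝ → ℝ)
    (hF1 : ∀ x1 x2, F1 x1 x2 = F1t x1)
    (hg11 : ∀ x1 x2, g11 x1 x2 = g11t x1)
    -- x1 ↦ F̃1 ρ1 is differentiable with integrable derivative, tending to 0 at ±∞
    (hFdiff : Differentiable ℝ (fun x1 => F1t x1 * ρ1 x1))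
    (hFint : Integrable (deriv (fun x1 => F1t x1 * ρ1 x1)))
    (hFtop : Tendsto (fun x1 => F1t x1 * ρ1 x1) atTop (𝓝 0))
    (hFbot : Tendsto (fun x1 => F1t x1 * ρ1 x1) atBot (𝓝 0))
    -- x1 ↦ g̃11 ρ1 is twice differentiable, it and its first derivative tend
    -- to 0 at ±∞, and its second derivative is integrable
    (hgdiff : Differentiable ℝ (fun x1 => g11t x1 * ρ1 x1))
    (hgdiff' : Differentiable ℝ (deriv (fun x1 => g11t x1 * ρ1 x1)))
    (hgtop : Tendsto (fun x1 => g11t x1 * ρ1 x1) atTop (𝓝 0))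
    (hgbot : Tendsto (fun x1 => g11t x1 * ρ1 x1) atBot (𝓝 0))
    (hg'top : Tendsto (deriv (fun x1 => g11t x1 * ρ1 x1)) atTop (𝓝 0))
    (hg'bot : Tendsto (deriv (fun x1 => g11t x1 * ρ1 x1)) atBot (𝓝 0))
    (hg''int : Integrable (deriv (deriv (fun x1 => g11t x1 * ρ1 x1))))
    -- both defining integrals of T_{2→1} converge absolutely
    (habs1 : Integrable (fun p : ℝ × ℝ =>
        ρ p.1 p.2 / ρ1 p.1 * deriv (fun t => F1 t p.2 * ρ1 t) p.1))
    (habs2 : Integrable (fun p : ℝ × ℝ =>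
        ρ p.1 p.2 / ρ1 p.1 * deriv (deriv (fun t => g11 t p.2 * ρ1 t)) p.1)) :
    -(∫ p : ℝ × ℝ, ρ p.1 p.2 / ρ1 p.1 * deriv (fun t => F1 t p.2 * ρ1 t) p.1)
    + (1/2) * ∫ p : ℝ × ℝ,
        ρ p.1 p.2 / ρ1 p.1 * deriv (deriv (fun t => g11 t p.2 * ρ1 t)) p.1
    = 0 := by
  simp only [hF1] at habs1 ⊢
  simp only [hg11] at habs2 ⊢
  rw [nil_aux ρ ρ1 hρ1 hρ1pos _ hFdiff hFint hFtop hFbot habs1,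
    nil_aux ρ ρ1 hρ1 hρ1pos _ hgdiff' hg''int hg'top hg'bot habs2]
  simp
end

section
/- Invariance of the information flow under nonlinear transformation of the remaining coordinate (density-level statement for d = 3). Let ρ : ℝ³ → ℝ be a probability density with ρ1 > 0 almost everywhere, F1 : ℝ³ → ℝ and g11 : ℝ³ → ℝ, and assume all integrals defining T_{2→1} converge absolutely. Let φ : ℝ → ℝ be a C¹ diffeomorphism with nowhere-vanishing derivative, and define the transformed density ρ̃(x1,x2,y) = ρ(x1,x2,φ⁻¹(y))·|(φ⁻¹)′(y)|, transformed drift F̃1(x1,x2,y) = F1(x1,x2,φ⁻¹(y)), and transformed diffusion coefficient g̃11(x1,x2,y) = g11(x1,x2,φ⁻¹(y)). Then the information flow computed from (ρ̃, F̃1, g̃11) equals the information flow computed from (ρ, F1, g11): T̃_{2→1} = T_{2→1}. -/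
open MeasureTheory Real

/-- Marginal density of the first coordinate: `ρ1(x1) = ∫ ρ(x) dx2 dx3`. -/
noncomputable def marg1 (ρ : ℝ → ℝ → ℝ → ℝ) (x1 : ℝ) : ℝ :=
  ∫ p : ℝ × ℝ, ρ x1 p.1 p.2

/-- Partial marginal with the second coordinate integrated out:
`ρ_{∖2}(x1,x3) = ∫ ρ(x) dx2`. -/
noncomputable def margNot2 (ρ : ℝ → ℝ → ℝ → ℝ) (x1 x3 : ℝ) : ℝ :=
  ∫ x2 : ℝ, ρ x1 x2 x3

/-- Joint marginal of the first two coordinates: `ρ12(x1,x2) = ∫ ρ(x) dx3`. -/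
noncomputable def marg12 (ρ : ℝ → ℝ → ℝ → ℝ) (x1 x2 : ℝ) : ℝ :=
  ∫ x3 : ℝ, ρ x1 x2 x3

/-- The rate of information flow from component 2 to component 1 for `d = 3`:
`T_{2→1} = −∫ ρ_{2|1}(x2|x1) ∂(F1 ρ_{∖2})/∂x1 dx
           + (1/2) ∫ ρ_{2|1}(x2|x1) ∂²(g11 ρ_{∖2})/∂x1² dx`. -/
noncomputable def infoFlow21 (ρ F1 g11 : ℝ → ℝ → ℝ → ℝ) : ℝ :=
  -(∫ q : ℝ × ℝ × ℝ, marg12 ρ q.1 q.2.1 / marg1 ρ q.1 *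
      deriv (fun t => F1 t q.2.1 q.2.2 * margNot2 ρ t q.2.2) q.1)
  + (1/2) * ∫ q : ℝ × ℝ × ℝ, marg12 ρ q.1 q.2.1 / marg1 ρ q.1 *
      deriv (deriv (fun t => g11 t q.2.1 q.2.2 * margNot2 ρ t q.2.2)) q.1

/-- The weighted measure is pushed to Lebesgue measure. -/
lemma aux_mp (ψ : ℝ → ℝ) (hψ : ContDiff ℝ 1 ψ) (hb : Function.Bijective ψ) :
    MeasurePreserving ψ
      ((volume : Measure ℝ).withDensity (fun y => ((‖deriv ψ y‖₊ : NNReal) : ENNReal))) volume := by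
  have hm : Measurable ψ := hψ.continuous.measurable
  refine ⟨hm, ?_⟩
  ext s hs
  rw [Measure.map_apply hm hs, withDensity_apply _ (hm hs)]
  have h := lintegral_image_eq_lintegral_abs_deriv_mul (s := ψ ⁻¹' s) (f := ψ) (f' := deriv ψ)
    (hm hs) (fun x _ => ((hψ.differentiable (by norm_num)) x).hasDerivAt.hasDerivWithinAt)
    hb.injective.injOn (fun _ => 1)
  rw [Set.image_preimage_eq s hb.surjective] at h
  simp only [lintegral_const, one_mul, mul_one, Measure.restrict_apply_univ] at h
  rw [h]
  refine lintegral_congr fun y => ?_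
  rw [← Real.norm_eq_abs, ofReal_norm]
  rfl

lemma aux_emb (φ ψ : ℝ → ℝ) (hφ : ContDiff ℝ 1 φ) (hψ : ContDiff ℝ 1 ψ)
    (hinv1 : Function.LeftInverse ψ φ) (hinv2 : Function.RightInverse ψ φ) :
    MeasurableEmbedding ψ :=
  MeasurableEquiv.measurableEmbedding
    { toFun := ψ, invFun := φ, left_inv := hinv2, right_inv := hinv1,
      measurable_toFun := hψ.continuous.measurable,
      measurable_invFun := hφ.continuous.measurable : ℝ ≃ᵐ ℝ }

lemma aux_w (ψ : ℝ → ℝ) (hψ : ContDiff ℝ 1 ψ) : Measurable (fun y => ‖deriv ψ y‖₊) :=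
  (hψ.continuous_deriv (by norm_num)).measurable.nnnorm

lemma aux1 (φ ψ : ℝ → ℝ) (hφ : ContDiff ℝ 1 φ) (hψ : ContDiff ℝ 1 ψ)
    (hinv1 : Function.LeftInverse ψ φ) (hinv2 : Function.RightInverse ψ φ) (f : ℝ → ℝ) :
    ∫ y, f (ψ y) * |deriv ψ y| = ∫ x, f x := by
  rw [← (aux_mp ψ hψ ⟨hinv2.injective, hinv1.surjective⟩).integral_comp
    (aux_emb φ ψ hφ hψ hinv1 hinv2) f, integral_withDensity_eq_integral_smul (aux_w ψ hψ)]
  refine integral_congr_ae (Filter.Eventually.of_forall fun y => ?_)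
  simp [NNReal.smul_def, mul_comm]

lemma aux2 (φ ψ : ℝ → ℝ) (hφ : ContDiff ℝ 1 φ) (hψ : ContDiff ℝ 1 ψ)
    (hinv1 : Function.LeftInverse ψ φ) (hinv2 : Function.RightInverse ψ φ) (f : ℝ × ℝ → ℝ) :
    ∫ p : ℝ × ℝ, f (p.1, ψ p.2) * |deriv ψ p.2| = ∫ p, f p := by
  have hmp := (MeasurePreserving.id (volume : Measure ℝ)).prod
    (aux_mp ψ hψ ⟨hinv2.injective, hinv1.surjective⟩)
  have he := (MeasurableEmbedding.id (α := ℝ) (mα := inferInstance)).prodMap (aux_emb φ ψ hφ hψ hinv1 hinv2)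
  have w2 : Measurable (fun z : ℝ × ℝ => ‖deriv ψ z.2‖₊) := (aux_w ψ hψ).comp measurable_snd
  rw [Measure.volume_eq_prod, ← hmp.integral_comp he f,
    prod_withDensity_right (aux_w ψ hψ).coe_nnreal_ennreal,
    integral_withDensity_eq_integral_smul w2]
  refine integral_congr_ae (Filter.Eventually.of_forall fun y => ?_)
  simp [NNReal.smul_def, mul_comm, Prod.map]

lemma aux3 (φ ψ : ℝ → ℝ) (hφ : ContDiff ℝ 1 φ) (hψ : ContDiff ℝ 1 ψ)
    (hinv1 : Function.LeftInverse ψ φ) (hinv2 : Function.RightInverse ψ φ)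
    (f : ℝ × ℝ × ℝ → ℝ) :
    ∫ p : ℝ × ℝ × ℝ, f (p.1, p.2.1, ψ p.2.2) * |deriv ψ p.2.2| = ∫ p, f p := by
  have hmp := (MeasurePreserving.id (volume : Measure ℝ)).prod
    ((MeasurePreserving.id (volume : Measure ℝ)).prod
      (aux_mp ψ hψ ⟨hinv2.injective, hinv1.surjective⟩))
  have he := (MeasurableEmbedding.id (α := ℝ) (mα := inferInstance)).prodMap
    ((MeasurableEmbedding.id (α := ℝ) (mα := inferInstance)).prodMap (aux_emb φ ψ hφ hψ hinv1 hinv2))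
  have w2 : Measurable (fun z : ℝ × ℝ => ‖deriv ψ z.2‖₊) := (aux_w ψ hψ).comp measurable_snd
  have w3 : Measurable (fun z : ℝ × ℝ × ℝ => ‖deriv ψ z.2.2‖₊) := w2.comp measurable_snd
  rw [Measure.volume_eq_prod, Measure.volume_eq_prod, ← hmp.integral_comp he f,
    prod_withDensity_right (aux_w ψ hψ).coe_nnreal_ennreal,
    prod_withDensity_right w2.coe_nnreal_ennreal,
    integral_withDensity_eq_integral_smul w3]
  refine integral_congr_ae (Filter.Eventually.of_forall fun y => ?_)
  simp [NNReal.smul_def, mul_comm, Prod.map]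

/-- **Invariance of the information flow under nonlinear
transformation of the remaining coordinate, `d = 3`.**
If `φ : ℝ → ℝ` is a `C¹` diffeomorphism (inverse `ψ`) with nowhere-vanishing
derivative, and `ρ̃, F̃1, g̃11` are the transformed density, drift and diffusion
coefficient under `x3 ↦ φ(x3)`, then `T̃_{2→1} = T_{2→1}`. -/
theorem stmt_3 (ρ F1 g11 : ℝ → ℝ → ℝ → ℝ)
    -- ρ is a probability density on ℝ³
    (hρ_nonneg : ∀ x1 x2 x3, 0 ≤ ρ x1 x2 x3)
    (hρ_int : Integrable (fun q : ℝ × ℝ × ℝ => ρ q.1 q.2.1 q.2.2))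
    (hρ_one : ∫ q : ℝ × ℝ × ℝ, ρ q.1 q.2.1 q.2.2 = 1)
    -- ρ1 > 0 almost everywhere
    (hρ1pos : ∀ᵐ x1 : ℝ, 0 < marg1 ρ x1)
    -- φ is a C¹ diffeomorphism with nowhere-vanishing derivative, inverse ψ
    (φ ψ : ℝ → ℝ)
    (hφ : ContDiff ℝ 1 φ) (hψ : ContDiff ℝ 1 ψ)
    (hinv1 : Function.LeftInverse ψ φ) (hinv2 : Function.RightInverse ψ φ)
    (hφ' : ∀ t, deriv φ t ≠ 0)
    -- the transformed density, drift and diffusion coefficient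
    (ρT F1T g11T : ℝ → ℝ → ℝ → ℝ)
    (hρT : ∀ x1 x2 y, ρT x1 x2 y = ρ x1 x2 (ψ y) * |deriv ψ y|)
    (hF1T : ∀ x1 x2 y, F1T x1 x2 y = F1 x1 x2 (ψ y))
    (hg11T : ∀ x1 x2 y, g11T x1 x2 y = g11 x1 x2 (ψ y))
    -- all integrals defining T_{2→1} converge absolutely (for both systems)
    (habs1 : Integrable (fun q : ℝ × ℝ × ℝ => marg12 ρ q.1 q.2.1 / marg1 ρ q.1 *
        deriv (fun t => F1 t q.2.1 q.2.2 * margNot2 ρ t q.2.2) q.1))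
    (habs2 : Integrable (fun q : ℝ × ℝ × ℝ => marg12 ρ q.1 q.2.1 / marg1 ρ q.1 *
        deriv (deriv (fun t => g11 t q.2.1 q.2.2 * margNot2 ρ t q.2.2)) q.1))
    (habs1T : Integrable (fun q : ℝ × ℝ × ℝ => marg12 ρT q.1 q.2.1 / marg1 ρT q.1 *
        deriv (fun t => F1T t q.2.1 q.2.2 * margNot2 ρT t q.2.2) q.1))
    (habs2T : Integrable (fun q : ℝ × ℝ × ℝ => marg12 ρT q.1 q.2.1 / marg1 ρT q.1 *
        deriv (deriv (fun t => g11T t q.2.1 q.2.2 * margNot2 ρT t q.2.2)) q.1)) :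
    infoFlow21 ρT F1T g11T = infoFlow21 ρ F1 g11 := by
  have h12 : ∀ a b, marg12 ρT a b = marg12 ρ a b := fun a b => by
    simp only [marg12, hρT]
    exact aux1 φ ψ hφ hψ hinv1 hinv2 (fun x => ρ a b x)
  have h1 : ∀ a, marg1 ρT a = marg1 ρ a := fun a => by
    simp only [marg1, hρT]
    exact aux2 φ ψ hφ hψ hinv1 hinv2 (fun p => ρ a p.1 p.2)
  have hn : ∀ a y, margNot2 ρT a y = margNot2 ρ a (ψ y) * |deriv ψ y| := fun a y => by
    simp only [margNot2, hρT]
    exact integral_mul_const _ _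
  have hd : ∀ (f : ℝ → ℝ) (c : ℝ), deriv (fun t => f t * c) = fun t => deriv f t * c :=
    fun f c => funext fun t => deriv_mul_const_field c
  unfold infoFlow21
  simp only [h12, h1, hn, hF1T, hg11T, ← mul_assoc, hd]
  congr 2
  · exact aux3 φ ψ hφ hψ hinv1 hinv2 (fun q => marg12 ρ q.1 q.2.1 / marg1 ρ q.1 *
      deriv (fun t => F1 t q.2.1 q.2.2 * margNot2 ρ t q.2.2) q.1)
  · exact aux3 φ ψ hφ hψ hinv1 hinv2 (fun q => marg12 ρ q.1 q.2.1 / marg1 ρ q.1 *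
      deriv (deriv (fun t => g11 t q.2.1 q.2.2 * margNot2 ρ t q.2.2)) q.1)
end

section
/- Information flow for linear systems with Gaussian state. Let d ≥ 2, let Σ = (σ_{ij}) be a symmetric positive definite d×d real matrix, μ ∈ ℝ^d, and let ρ : ℝ^d → ℝ be the Gaussian density ρ(x) = (2π)^{−d/2} (det Σ)^{−1/2} exp(−(1/2)(x−μ)ᵀ Σ⁻¹ (x−μ)). Let the drift be linear, F1(x) = f1 + Σ_{k=1}^d a_{1k} x_k with real constants f1, a_{11},…,a_{1d}, and let g11 > 0 be constant. Then the rate of information flow from component 2 to component 1 equals T_{2→1} = a_{12} σ_{12} / σ_{11}. -/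
open MeasureTheory Real Matrix

lemma aux_coercive {n : ℕ} (A : Matrix (Fin n) (Fin n) ℝ) (hA : ∀ x, x ≠ 0 → 0 < x ⬝ᵥ (A *ᵥ x)) :
    ∃ ε > 0, ∀ w : Fin n → ℝ, ε * ‖w‖ ^ 2 ≤ w ⬝ᵥ (A *ᵥ w) := by
  have hc : Continuous (fun w : Fin n → ℝ => w ⬝ᵥ (A *ᵥ w)) := by fun_prop
  rcases (Metric.sphere (0 : Fin n → ℝ) 1).eq_empty_or_nonempty with h | h
  · refine ⟨1, one_pos, fun w => ?_⟩
    by_cases hw : w = 0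
    · simp [hw]
    · exfalso
      have : (‖w‖⁻¹ • w) ∈ Metric.sphere (0 : Fin n → ℝ) 1 := by
        simp [norm_smul, hw]
      simp [h] at this
  · obtain ⟨w0, hw0, hmin⟩ := (isCompact_sphere (0 : Fin n → ℝ) 1).exists_isMinOn h hc.continuousOn
    have hw00 : w0 ≠ 0 := by
      rintro rfl
      simp at hw0
    refine ⟨_, hA w0 hw00, fun w => ?_⟩
    by_cases hw : w = 0
    · simp [hw]
    have hs : (‖w‖⁻¹ • w) ∈ Metric.sphere (0 : Fin n → ℝ) 1 := by
      simp [norm_smul, hw]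
    have := hmin hs
    simp only [Set.mem_ofPred_eq, mulVec_smul, dotProduct_smul, smul_dotProduct, smul_eq_mul] at this
    have hn : 0 < ‖w‖ := norm_pos_iff.2 hw
    calc _ ≤ (‖w‖⁻¹ * (‖w‖⁻¹ * w ⬝ᵥ A *ᵥ w)) * ‖w‖ ^ 2 := by gcongr
      _ = _ := by field_simp

lemma aux_integrable {E : Type*} [NormedAddCommGroup E] [NormedSpace ℝ E] [FiniteDimensional ℝ E]
    [MeasurableSpace E] [BorelSpace E] (ν : Measure E) [ν.IsAddHaarMeasure]
    (f : E → ℝ) (hf : Continuous f) (x0 : E) (K ε : ℝ) (hε : 0 < ε)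
    (hb : ∀ x, |f x| ≤ K * ((1 + ‖x - x0‖) ^ 2 * Real.exp (-(ε * ‖x - x0‖ ^ 2)))) :
    Integrable f ν := by
  set N : ℕ := Module.finrank ℝ E + 1
  have h1 : Integrable (fun x : E => (1 + ‖x‖) ^ (-(N : ℝ))) ν :=
    integrable_one_add_norm (by simp [N])
  have h2 := h1.comp_sub_right x0
  have hK : 0 ≤ K := by
    have := (abs_nonneg _).trans (hb x0)
    simpa using this
  refine (h2.const_mul (K * (2 ^ (N + 2) * ((N + 2).factorial * ε⁻¹ ^ (N + 2) * Real.exp ε)))).mono'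
    hf.aestronglyMeasurable (Filter.Eventually.of_forall fun x => ?_)
  rw [Real.norm_eq_abs]
  refine (hb x).trans ?_
  set t := ‖x - x0‖
  have ht : 0 ≤ t := norm_nonneg _
  rw [Real.rpow_neg (by positivity), Real.rpow_natCast, mul_assoc]
  refine mul_le_mul_of_nonneg_left ?_ hK
  rw [← div_eq_mul_inv, le_div_iff₀ (by positivity)]
  have e1 : (1 + t) ^ (N + 2) ≤ 2 ^ (N + 2) * (1 + t ^ 2) ^ (N + 2) := by
    rw [← mul_pow]
    gcongr
    nlinarith [sq_nonneg (t - 1)]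
  have e2 := Real.pow_div_factorial_le_exp (ε * (1 + t ^ 2)) (by positivity) (N + 2)
  rw [div_le_iff₀ (by positivity), mul_pow] at e2
  have e3 : Real.exp (ε * (1 + t ^ 2)) * Real.exp (-(ε * t ^ 2)) = Real.exp ε := by
    rw [← Real.exp_add]; congr 1; ring
  have e4 : (1 + t ^ 2) ^ (N + 2) ≤ ε⁻¹ ^ (N + 2) * (Real.exp (ε * (1 + t ^ 2)) * (N + 2).factorial) := by
    rw [inv_pow, ← div_eq_inv_mul, le_div_iff₀ (by positivity)]
    linarith
  calc _ = (1 + t) ^ (N + 2) * Real.exp (-(ε * t ^ 2)) := by ring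
    _ ≤ (2 ^ (N + 2) * (ε⁻¹ ^ (N + 2) * (Real.exp (ε * (1 + t ^ 2)) * (N + 2).factorial)))
         * Real.exp (-(ε * t ^ 2)) := by
        gcongr
        exact e1.trans (by gcongr)
    _ = 2 ^ (N + 2) * ((N + 2).factorial * ε⁻¹ ^ (N + 2) * (Real.exp (ε * (1 + t ^ 2)) * Real.exp (-(ε * t ^ 2)))) := by ring
    _ = _ := by rw [e3]

lemma aux_total {n : ℕ} (S : Matrix (Fin n) (Fin n) ℝ) (hS : S.PosDef) (μ : Fin n → ℝ) :
    ∫ x : Fin n → ℝ, (2 * π) ^ (-(n : ℝ) / 2) * S.det ^ (-(1 : ℝ) / 2) *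
        Real.exp (-(1 / 2) * ((x - μ) ⬝ᵥ (S⁻¹ *ᵥ (x - μ)))) = 1 := by
  rw [integral_sub_right_eq_self (fun x : Fin n → ℝ => (2 * π) ^ (-(n : ℝ) / 2) * S.det ^ (-(1 : ℝ) / 2) *
        Real.exp (-(1 / 2) * (x ⬝ᵥ (S⁻¹ *ᵥ x)))) μ, integral_const_mul]
  obtain ⟨B, hB⟩ : ∃ B : Matrix (Fin n) (Fin n) ℝ, S = Bᵀ * B := by
    open scoped MatrixOrder in
    obtain ⟨B, hB⟩ := CStarAlgebra.nonneg_iff_eq_star_mul_self.1 hS.posSemidef.nonneg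
    exact ⟨B, by simpa [star_eq_conjTranspose] using hB⟩
  have hdet : S.det = B.det ^ 2 := by rw [hB]; simp [sq]
  have hdpos : 0 < S.det := hS.det_pos
  have hB0 : B.det ≠ 0 := by rintro h; simp [h] at hdet; linarith
  have hmap := Real.map_matrix_volume_pi_eq_smul_volume_pi (M := Bᵀ) (by simpa using hB0)
  have hI : ∫ x, Real.exp (-(1 / 2) * (x ⬝ᵥ (S⁻¹ *ᵥ x))) ∂(Measure.map (toLin' Bᵀ) volume)
      = (√(2 * π)) ^ n := by
    rw [integral_map (by fun_prop) (by fun_prop)]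
    have : ∀ z : Fin n → ℝ, Real.exp (-(1 / 2) * ((toLin' Bᵀ z) ⬝ᵥ (S⁻¹ *ᵥ (toLin' Bᵀ z))))
       = ∏ i, Real.exp (-(1/2) * z i ^ 2) := by
      intro z
      rw [← Real.exp_sum, ← Finset.mul_sum]
      congr 2
      have hBu : IsUnit B.det := hB0.isUnit
      have hBtu : IsUnit Bᵀ.det := by simpa using hBu
      have : S⁻¹ *ᵥ (Bᵀ *ᵥ z) = B⁻¹ *ᵥ z := by
        rw [hB, Matrix.mul_inv_rev, mulVec_mulVec, Matrix.mul_assoc, Matrix.nonsing_inv_mul _ hBtu, Matrix.mul_one]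
      rw [toLin'_apply, this, mulVec_transpose, ← dotProduct_mulVec, mulVec_mulVec, Matrix.mul_nonsing_inv _ hBu, one_mulVec]
      simp [dotProduct, sq]
    simp_rw [this]
    rw [integral_fintype_prod_volume_eq_pow (fun x : ℝ => Real.exp (-(1/2) * x ^ 2)), integral_gaussian]
    rw [Fintype.card_fin]
    congr 2
    ring
  rw [hmap, integral_smul_measure, ENNReal.toReal_ofReal (abs_nonneg _)] at hI
  have hdB : √S.det = |B.det| := by rw [hdet, Real.sqrt_sq_eq_abs]
  have hpi : (0:ℝ) < 2 * π := by positivity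
  have h1 : (2 * π) ^ (-(n : ℝ) / 2) = ((√(2 * π)) ^ n)⁻¹ := by
    rw [Real.sqrt_eq_rpow, ← Real.rpow_natCast, ← Real.rpow_mul hpi.le, ← Real.rpow_neg hpi.le]
    congr 1; ring
  have h2 : S.det ^ (-(1 : ℝ) / 2) = |B.det|⁻¹ := by
    rw [← hdB, Real.sqrt_eq_rpow, ← Real.rpow_neg hdpos.le]; congr 1; ring
  rw [h1, h2, mul_assoc]
  rw [det_transpose, abs_inv, smul_eq_mul] at hI
  rw [hI]
  exact inv_mul_cancel₀ (by positivity)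

lemma aux_ibp {n : ℕ} (A : Matrix (Fin n) (Fin n) ℝ) (hsym : A.IsSymm)
    (hA : ∀ x, x ≠ 0 → 0 < x ⬝ᵥ (A *ᵥ x)) (μ D l : Fin n → ℝ) (l0 : ℝ) :
    Integrable (fun x : Fin n → ℝ => Real.exp (-(1 / 2) * ((x - μ) ⬝ᵥ (A *ᵥ (x - μ))))) ∧
    Integrable (fun x : Fin n → ℝ => (l ⬝ᵥ D - (l0 + l ⬝ᵥ x) * (D ⬝ᵥ A *ᵥ (x - μ))) *
      Real.exp (-(1 / 2) * ((x - μ) ⬝ᵥ (A *ᵥ (x - μ))))) ∧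
    ∫ x : Fin n → ℝ, (l ⬝ᵥ D - (l0 + l ⬝ᵥ x) * (D ⬝ᵥ A *ᵥ (x - μ))) *
      Real.exp (-(1 / 2) * ((x - μ) ⬝ᵥ (A *ᵥ (x - μ)))) = 0 := by
  obtain ⟨ε, hε, hco⟩ := aux_coercive A hA
  -- bound for linear forms
  have hlin : ∀ v : Fin n → ℝ, ∃ C, 0 ≤ C ∧ ∀ w : Fin n → ℝ, |v ⬝ᵥ w| ≤ C * ‖w‖ := by
    intro v
    refine ⟨∑ i, |v i|, by positivity, fun w => ?_⟩
    rw [dotProduct, Finset.sum_mul]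
    refine (Finset.abs_sum_le_sum_abs _ _).trans (Finset.sum_le_sum fun i _ => ?_)
    rw [abs_mul]
    gcongr
    exact norm_le_pi_norm w i
  have key : ∀ (φ : (Fin n → ℝ) → ℝ) (C : ℝ), Continuous φ → (∀ x, |φ x| ≤ C * (1 + ‖x - μ‖) ^ 2) →
      Integrable (fun x : Fin n → ℝ => φ x * Real.exp (-(1 / 2) * ((x - μ) ⬝ᵥ (A *ᵥ (x - μ))))) := by
    intro φ C hφ hb
    refine aux_integrable volume _ (by fun_prop) μ C (ε / 2) (by positivity) fun x => ?_
    rw [abs_mul, Real.abs_exp, ← mul_assoc]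
    refine mul_le_mul (hb x) ?_ (Real.exp_pos _).le ((abs_nonneg _).trans (hb x))
    rw [Real.exp_le_exp]
    linarith [hco (x - μ)]
  obtain ⟨C1, hC1, hl⟩ := hlin l
  obtain ⟨C2, hC2, hD⟩ := hlin (D ᵥ* A)
  have hD' : ∀ w, |D ⬝ᵥ A *ᵥ w| ≤ C2 * ‖w‖ := fun w => by rw [dotProduct_mulVec]; exact hD w
  have hlx : ∀ x, |l0 + l ⬝ᵥ x| ≤ (|l0 + l ⬝ᵥ μ| + C1) * (1 + ‖x - μ‖) := by
    intro x
    have : l0 + l ⬝ᵥ x = (l0 + l ⬝ᵥ μ) + l ⬝ᵥ (x - μ) := by rw [dotProduct_sub]; ring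
    rw [this]
    refine (abs_add_le _ _).trans ?_
    nlinarith [hl (x - μ), abs_nonneg (l0 + l ⬝ᵥ μ), norm_nonneg (x - μ)]
  have i0 := key (fun _ => 1) 1 (by fun_prop) (fun x => by
    simp only [abs_one]; nlinarith [norm_nonneg (x - μ)])
  have i1 := key (fun _ => l ⬝ᵥ D) |l ⬝ᵥ D| (by fun_prop) (fun x => by
    nlinarith [norm_nonneg (x - μ), abs_nonneg (l ⬝ᵥ D), mul_nonneg (abs_nonneg (l ⬝ᵥ D)) (norm_nonneg (x - μ)), sq_nonneg (‖x - μ‖), mul_nonneg (abs_nonneg (l ⬝ᵥ D)) (sq_nonneg (‖x - μ‖))])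
  have i2 := key (fun x => l0 + l ⬝ᵥ x) (|l0 + l ⬝ᵥ μ| + C1) (by fun_prop) (fun x => by
    refine (hlx x).trans ?_
    gcongr
    nlinarith [norm_nonneg (x - μ)])
  have i3 := key (fun x => (l0 + l ⬝ᵥ x) * (D ⬝ᵥ A *ᵥ (x - μ))) ((|l0 + l ⬝ᵥ μ| + C1) * C2) (by fun_prop) (fun x => by
    rw [abs_mul]
    calc _ ≤ ((|l0 + l ⬝ᵥ μ| + C1) * (1 + ‖x - μ‖)) * (C2 * (1 + ‖x - μ‖)) := by
          gcongr
          · exact hlx x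
          · refine (hD' _).trans ?_
            gcongr; linarith
      _ = _ := by ring)
  refine ⟨by simpa using i0, by simp only [sub_mul]; exact i1.sub i3, ?_⟩
  have hline1 : ∀ x, HasLineDerivAt ℝ (fun x : Fin n → ℝ => l0 + l ⬝ᵥ x) (l ⬝ᵥ D) x D := by
    intro x
    have : (fun t : ℝ => l0 + l ⬝ᵥ (x + t • D)) = fun t => (l0 + l ⬝ᵥ x) + t * (l ⬝ᵥ D) := by
      ext t; rw [dotProduct_add, dotProduct_smul, smul_eq_mul]; ring
    unfold HasLineDerivAt
    rw [this]
    simpa using ((hasDerivAt_id (0:ℝ)).mul_const (l ⬝ᵥ D)).const_add (l0 + l ⬝ᵥ x)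
  have hline2 : ∀ x, HasLineDerivAt ℝ (fun x : Fin n → ℝ => Real.exp (-(1 / 2) * ((x - μ) ⬝ᵥ (A *ᵥ (x - μ)))))
      (-(D ⬝ᵥ A *ᵥ (x - μ)) * Real.exp (-(1 / 2) * ((x - μ) ⬝ᵥ (A *ᵥ (x - μ))))) x D := by
    intro x
    have hs : (x - μ) ⬝ᵥ A *ᵥ D = D ⬝ᵥ A *ᵥ (x - μ) := by
      rw [dotProduct_mulVec, ← mulVec_transpose, hsym.eq, dotProduct_comm]
    have : (fun t : ℝ => Real.exp (-(1 / 2) * ((x + t • D - μ) ⬝ᵥ (A *ᵥ (x + t • D - μ)))))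
       = fun t => Real.exp (-(1 / 2) * ((x - μ) ⬝ᵥ (A *ᵥ (x - μ))) + (-(D ⬝ᵥ A *ᵥ (x - μ)) * t + (-(1 / 2) * D ⬝ᵥ A *ᵥ D) * t ^ 2)) := by
      ext t
      have : x + t • D - μ = (x - μ) + t • D := by abel
      rw [this]
      simp only [mulVec_add, mulVec_smul, dotProduct_add, add_dotProduct, dotProduct_smul, smul_dotProduct, smul_eq_mul, hs]
      congr 1; ring
    unfold HasLineDerivAt
    rw [this]
    have h := ((((hasDerivAt_id (0:ℝ)).const_mul (-(D ⬝ᵥ A *ᵥ (x - μ)))).add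
      (((hasDerivAt_id (0:ℝ)).pow 2).const_mul (-(1 / 2) * D ⬝ᵥ A *ᵥ D))).const_add (-(1 / 2) * ((x - μ) ⬝ᵥ (A *ᵥ (x - μ))))).exp
    refine h.congr_deriv ?_
    simp
    ring
  have := integral_bilinear_hasLineDerivAt_right_eq_neg_left_of_integrable (μ := volume) (B := ContinuousLinearMap.mul ℝ ℝ)
    (f := fun x : Fin n → ℝ => l0 + l ⬝ᵥ x) (f' := fun _ => l ⬝ᵥ D) (v := D)
    (g := fun x : Fin n → ℝ => Real.exp (-(1 / 2) * ((x - μ) ⬝ᵥ (A *ᵥ (x - μ)))))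
    (g' := fun x => -(D ⬝ᵥ A *ᵥ (x - μ)) * Real.exp (-(1 / 2) * ((x - μ) ⬝ᵥ (A *ᵥ (x - μ)))))
    (by simpa using i1)
    (by refine i3.neg.congr (Filter.Eventually.of_forall fun x => ?_); simp only [ContinuousLinearMap.mul_apply', Pi.neg_apply]; ring) (by simpa only [ContinuousLinearMap.mul_apply'] using i2) (fun x _ => hline1 x) (fun x _ => hline2 x)
  simp only [ContinuousLinearMap.mul_apply'] at this
  simp only [sub_mul]
  rw [integral_sub i1 i3]
  rw [← neg_eq_iff_eq_neg, ← integral_neg] at this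
  rw [← this, sub_eq_zero]
  congr 1; ext x; ring

lemma aux_deriv {n : ℕ} (A : Matrix (Fin n) (Fin n) ℝ) (hsym : A.IsSymm) (z D : Fin n → ℝ) (t : ℝ) :
    HasDerivAt (fun t : ℝ => Real.exp (-(1 / 2) * ((z + t • D) ⬝ᵥ (A *ᵥ (z + t • D)))))
      (-(D ⬝ᵥ A *ᵥ (z + t • D)) * Real.exp (-(1 / 2) * ((z + t • D) ⬝ᵥ (A *ᵥ (z + t • D))))) t := by
  have hs : z ⬝ᵥ A *ᵥ D = D ⬝ᵥ A *ᵥ z := by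
    rw [dotProduct_mulVec, ← mulVec_transpose, hsym.eq, dotProduct_comm]
  have : ∀ t : ℝ, -(1 / 2) * ((z + t • D) ⬝ᵥ (A *ᵥ (z + t • D)))
      = -(1 / 2) * (z ⬝ᵥ (A *ᵥ z)) + (-(D ⬝ᵥ A *ᵥ z) * t + (-(1 / 2) * D ⬝ᵥ A *ᵥ D) * t ^ 2) := by
    intro t
    simp only [mulVec_add, mulVec_smul, dotProduct_add, add_dotProduct, dotProduct_smul,
      smul_dotProduct, smul_eq_mul, hs]
    ring
  simp only [this]
  have h := ((((hasDerivAt_id t).const_mul (-(D ⬝ᵥ A *ᵥ z))).add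
    (((hasDerivAt_id t).pow 2).const_mul (-(1 / 2) * D ⬝ᵥ A *ᵥ D))).const_add
      (-(1 / 2) * (z ⬝ᵥ (A *ᵥ z)))).exp
  refine h.congr_deriv ?_
  simp [mulVec_add, mulVec_smul, dotProduct_add]
  ring

lemma aux_M {n : ℕ} (Q : Matrix (Fin n) (Fin n) ℝ) (hsym : Q.IsSymm)
    (hQ : ∀ x, x ≠ 0 → 0 < x ⬝ᵥ (Q *ᵥ x)) (i0 i1 : Fin n) (hi : i0 ≠ i1) (k β : ℝ) (hβ : 0 < β) :
    0 < Q i1 i1 ∧ ∃ M : Matrix (Fin n) (Fin n) ℝ, M.IsSymm ∧ M *ᵥ (Pi.single i1 1) = 0 ∧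
      (∀ w, w ⬝ᵥ (Q *ᵥ w) = w ⬝ᵥ (M *ᵥ w) + (Q i1 ⬝ᵥ w) ^ 2 / Q i1 i1) ∧
      (∀ w, w ≠ 0 → 0 < w ⬝ᵥ (M *ᵥ w) + β * (w i1 - k * w i0) ^ 2) := by
  have hpos : 0 < Q i1 i1 := by
    have := hQ (Pi.single i1 1) (by simp)
    simpa using this
  refine ⟨hpos, Q - (Q i1 i1)⁻¹ • vecMulVec (Q i1) (Q i1), ?_⟩
  have hMw : ∀ w, (Q - (Q i1 i1)⁻¹ • vecMulVec (Q i1) (Q i1)) *ᵥ w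
      = Q *ᵥ w - ((Q i1 i1)⁻¹ * (Q i1 ⬝ᵥ w)) • Q i1 := by
    intro w
    ext i
    simp [sub_mulVec, smul_mulVec, vecMulVec_mulVec]
    ring
  have h1 : (Q - (Q i1 i1)⁻¹ • vecMulVec (Q i1) (Q i1)) *ᵥ (Pi.single i1 1) = 0 := by
    rw [hMw]
    ext i
    have := congrFun (congrFun hsym.eq i) i1
    simp only [transpose_apply] at this
    simp [this, hpos.ne']
  have h2 : ∀ w, w ⬝ᵥ (Q *ᵥ w) = w ⬝ᵥ ((Q - (Q i1 i1)⁻¹ • vecMulVec (Q i1) (Q i1)) *ᵥ w)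
      + (Q i1 ⬝ᵥ w) ^ 2 / Q i1 i1 := by
    intro w
    rw [hMw, dotProduct_sub, dotProduct_smul, smul_eq_mul, dotProduct_comm w (Q i1)]
    field_simp
    ring
  have hMs : (Q - (Q i1 i1)⁻¹ • vecMulVec (Q i1) (Q i1)).IsSymm := by
    ext i j
    have := congrFun (congrFun hsym.eq i) j
    simp only [transpose_apply] at this
    simp only [transpose_apply, Matrix.sub_apply, Matrix.smul_apply, vecMulVec_apply, smul_eq_mul, this]
    ring
  refine ⟨hMs, h1, h2, ?_⟩
  generalize (Q - (Q i1 i1)⁻¹ • vecMulVec (Q i1) (Q i1)) = M at *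
  intro w hw
  set s := (Q i1 ⬝ᵥ w) / Q i1 i1 with hs
  have hp : (w - s • Pi.single i1 1) ⬝ᵥ (Q *ᵥ (w - s • Pi.single i1 1)) = w ⬝ᵥ (M *ᵥ w) := by
    have e1 : (Pi.single i1 1 : Fin n → ℝ) ⬝ᵥ (M *ᵥ w) = 0 := by
      rw [dotProduct_mulVec, ← mulVec_transpose, hMs.eq, h1, zero_dotProduct]
    rw [h2, mulVec_sub, mulVec_smul, h1, smul_zero, sub_zero, sub_dotProduct, smul_dotProduct, e1]
    simp [dotProduct_sub, hs]
    field_simp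
    simp
  by_cases h0 : w - s • Pi.single i1 1 = 0
  · have hw' : w = s • Pi.single i1 1 := sub_eq_zero.1 h0
    have hs0 : s ≠ 0 := by
      intro h; rw [h] at hw'; simp at hw'; exact hw hw'
    rw [← hp, h0, zero_dotProduct, zero_add, hw']
    simp [hi]
    positivity
  · have := hQ _ h0
    rw [hp] at this
    positivity

lemma aux_mp_s4 (m : ℕ) (e : ℝ × ℝ × (Fin m → ℝ) → Fin (m + 2) → ℝ)
    (he : ∀ p : ℝ × ℝ × (Fin m → ℝ), e p = Fin.cons p.1 (Fin.cons p.2.1 p.2.2)) :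
    MeasurePreserving e ∧ MeasurableEmbedding e := by
  let E1 := (MeasurableEquiv.piFinSuccAbove (fun _ : Fin (m + 1) => ℝ) 0).symm
  let E2 := (MeasurableEquiv.piFinSuccAbove (fun _ : Fin (m + 2) => ℝ) 0).symm
  let E3 := (MeasurableEquiv.prodCongr (MeasurableEquiv.refl ℝ) E1).trans E2
  have h1 : MeasurePreserving E1 := (volume_preserving_piFinSuccAbove (fun _ : Fin (m + 1) => ℝ) 0).symm _
  have h2 : MeasurePreserving E2 := (volume_preserving_piFinSuccAbove (fun _ : Fin (m + 2) => ℝ) 0).symm _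
  have heq : e = E3 := by
    ext p : 1
    rw [he]
    simp [E3, E1, E2, MeasurableEquiv.piFinSuccAbove, MeasurableEquiv.prodCongr, Fin.insertNthEquiv]
  rw [heq]
  refine ⟨?_, E3.measurableEmbedding⟩
  exact h2.comp ((MeasurePreserving.id volume).prod h1)

lemma aux_12 {n : ℕ} (S : Matrix (Fin n) (Fin n) ℝ) (hsym : S.IsSymm) (hS : S.PosDef)
    (i0 i1 : Fin n) (hi : i0 ≠ i1) :
    0 < S i0 i0 ∧ 0 < S i0 i0 * S i1 i1 - S i0 i1 ^ 2 ∧ ∀ u1 u2 : ℝ, ∃ p : Fin n → ℝ, p i0 = u1 ∧ p i1 = u2 ∧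
     ∀ w, w i0 = u1 → w i1 = u2 → w ⬝ᵥ (S⁻¹ *ᵥ w) =
      (u1 ^ 2 / S i0 i0 + S i0 i0 / (S i0 i0 * S i1 i1 - S i0 i1 ^ 2) * (u2 - S i0 i1 / S i0 i0 * u1) ^ 2)
      + (w - p) ⬝ᵥ (S⁻¹ *ᵥ (w - p)) := by
  have h10 : S i1 i0 = S i0 i1 := congrFun (congrFun hsym.eq i0) i1
  have hp0 : 0 < S i0 i0 := hS.diag_pos
  have hvec : ∀ (a b : ℝ) (v : Fin n → ℝ), (a • (Pi.single i0 1 : Fin n → ℝ) + b • Pi.single i1 1) ⬝ᵥ v = a * v i0 + b * v i1 := by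
    intro a b v; simp [add_dotProduct]
  have hvS : ∀ (a b : ℝ) i, (S *ᵥ (a • (Pi.single i0 1 : Fin n → ℝ) + b • Pi.single i1 1)) i = a * S i i0 + b * S i i1 := by
    intro a b v; simp [mulVec_add, mulVec_smul]
  have hΔ : 0 < S i0 i0 * S i1 i1 - S i0 i1 ^ 2 := by
    have := hS.dotProduct_mulVec_pos (x := (-S i0 i1) • (Pi.single i0 1 : Fin n → ℝ) + S i0 i0 • Pi.single i1 1)
      (by
        intro h
        have := congrFun h i1
        simp [hi.symm] at this
        linarith)
    rw [star_trivial, hvec, hvS, hvS, h10] at this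
    have h' : 0 < S i0 i0 * (S i0 i0 * S i1 i1 - S i0 i1 ^ 2) := by linarith
    exact pos_of_mul_pos_right h' hp0.le
  refine ⟨hp0, hΔ, fun u1 u2 => ?_⟩
  set Δ := S i0 i0 * S i1 i1 - S i0 i1 ^ 2 with hΔd
  set c : Fin n → ℝ := ((S i1 i1 * u1 - S i0 i1 * u2) / Δ) • (Pi.single i0 1 : Fin n → ℝ)
    + ((S i0 i0 * u2 - S i0 i1 * u1) / Δ) • Pi.single i1 1 with hc
  have hc0 : (S *ᵥ c) i0 = u1 := by
    rw [hc, hvS]; field_simp; rw [hΔd]; ring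
  have hc1 : (S *ᵥ c) i1 = u2 := by
    rw [hc, hvS, h10]; field_simp; rw [hΔd]; ring
  refine ⟨S *ᵥ c, hc0, hc1, fun w hw0 hw1 => ?_⟩
  have hu : IsUnit S.det := hS.det_pos.ne'.isUnit
  have hQc : S⁻¹ *ᵥ (S *ᵥ c) = c := by
    rw [mulVec_mulVec, Matrix.nonsing_inv_mul _ hu, one_mulVec]
  have hsym' : S⁻¹.IsSymm := by
    rw [IsSymm, transpose_nonsing_inv, hsym.eq]
  have hpw : (S *ᵥ c) ⬝ᵥ (S⁻¹ *ᵥ w) = c ⬝ᵥ w := by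
    rw [dotProduct_mulVec, ← mulVec_transpose, hsym'.eq, hQc]
  rw [mulVec_sub, hQc, dotProduct_sub, sub_dotProduct, sub_dotProduct, hpw, dotProduct_comm w c,
    dotProduct_comm (S *ᵥ c) c, hc, hvec, hvec, ← hc, hc0, hc1, hw0, hw1]
  field_simp
  rw [hΔd]
  ring

/-- **Information flow for linear systems with Gaussian state.**
Let `d = m + 2 ≥ 2`, let `S = (σ_{ij})` be a symmetric positive definite `d×d`
matrix, `μ ∈ ℝ^d`, and let `ρ` be the Gaussian density with mean `μ` and
covariance `S`.  With linear drift `F1(x) = f1 + Σ_k a_k x_k` and constant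
diffusion coefficient `g11 > 0`, the rate of information flow
`T_{2→1} = −∫ ρ_{2|1} ∂(F1 ρ_{∖2})/∂x1 dx + (1/2) ∫ ρ_{2|1} ∂²(g11 ρ_{∖2})/∂x1² dx`
equals `a_{12} σ_{12} / σ_{11}`.  The state space `ℝ^d` is represented as
`ℝ × ℝ × (Fin m → ℝ)` (for `m = 0` the last factor carries the canonical
probability measure, so the inner integrals over `x3,…,xd` are absent). -/
theorem stmt_4 (m : ℕ)
    (S : Matrix (Fin (m + 2)) (Fin (m + 2)) ℝ) (hS_symm : S.IsSymm) (hS_pd : S.PosDef)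
    (μ : Fin (m + 2) → ℝ) (f1 g11 : ℝ) (hg11 : 0 < g11) (a : Fin (m + 2) → ℝ)
    -- the identification of ℝ × ℝ × (Fin m → ℝ) with ℝ^d
    (e : ℝ × ℝ × (Fin m → ℝ) → Fin (m + 2) → ℝ)
    (he : ∀ p : ℝ × ℝ × (Fin m → ℝ), e p = Fin.cons p.1 (Fin.cons p.2.1 p.2.2))
    -- the Gaussian density
    (ρ : ℝ → ℝ → (Fin m → ℝ) → ℝ)
    (hρ : ∀ x1 x2 y, ρ x1 x2 y =
      (2 * π) ^ (-((m + 2 : ℕ) : ℝ) / 2) * S.det ^ (-(1 : ℝ) / 2) *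
        Real.exp (-(1 / 2) * ((e (x1, x2, y) - μ) ⬝ᵥ (S⁻¹ *ᵥ (e (x1, x2, y) - μ)))))
    -- the linear drift
    (F1 : ℝ → ℝ → (Fin m → ℝ) → ℝ)
    (hF1 : ∀ x1 x2 y, F1 x1 x2 y = f1 + ∑ k, a k * e (x1, x2, y) k)
    -- the marginals
    (ρ1 : ℝ → ℝ) (hρ1 : ∀ x1, ρ1 x1 = ∫ q : ℝ × (Fin m → ℝ), ρ x1 q.1 q.2)
    (ρm2 : ℝ → (Fin m → ℝ) → ℝ) (hρm2 : ∀ x1 y, ρm2 x1 y = ∫ x2 : ℝ, ρ x1 x2 y)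
    (ρ12 : ℝ → ℝ → ℝ) (hρ12 : ∀ x1 x2, ρ12 x1 x2 = ∫ y : Fin m → ℝ, ρ x1 x2 y) :
    -(∫ q : ℝ × ℝ × (Fin m → ℝ),
        ρ12 q.1 q.2.1 / ρ1 q.1 * deriv (fun t => F1 t q.2.1 q.2.2 * ρm2 t q.2.2) q.1)
    + (1 / 2) * ∫ q : ℝ × ℝ × (Fin m → ℝ),
        ρ12 q.1 q.2.1 / ρ1 q.1 * deriv (deriv (fun t => g11 * ρm2 t q.2.2)) q.1
    = a 1 * S 0 1 / S 0 0 := by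
  have e0 : ∀ p, e p 0 = p.1 := fun p => by rw [he]; rfl
  have e1 : ∀ p, e p 1 = p.2.1 := fun p => by rw [he]; rfl
  have e2 : ∀ p (j : Fin m), e p j.succ.succ = p.2.2 j := fun p j => by rw [he]; rfl
  have hec : Continuous e := by
    refine continuous_pi fun i => ?_
    refine Fin.cases ?_ (fun i => Fin.cases ?_ (fun j => ?_) i) i
    · simp only [e0]; fun_prop
    · simp only [Fin.succ_zero_eq_one, e1]; fun_prop
    · simp only [e2]; fun_prop
  obtain ⟨mp, emb⟩ := aux_mp_s4 m e he
  have h01 : (0 : Fin (m + 2)) ≠ 1 := by simp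
  have hQpd := hS_pd.inv
  have hQ : ∀ x, x ≠ 0 → 0 < x ⬝ᵥ (S⁻¹ *ᵥ x) := fun x hx => by
    simpa using hQpd.dotProduct_mulVec_pos hx
  have hQs : S⁻¹.IsSymm := by rw [IsSymm, transpose_nonsing_inv, hS_symm.eq]
  obtain ⟨hS0, hΔ, h12⟩ := aux_12 S hS_symm hS_pd 0 1 h01
  set k := S 0 1 / S 0 0 with hk
  set β := S 0 0 / (S 0 0 * S 1 1 - S 0 1 ^ 2) with hβd
  have hβ : 0 < β := by positivity
  obtain ⟨hQ1, M, hMs, hM1, hMq, hMpd⟩ := aux_M S⁻¹ hQs hQ 0 1 h01 k β hβ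
  have htot := aux_total S hS_pd μ
  set C : ℝ := (2 * π) ^ (-((m + 2 : ℕ) : ℝ) / 2) * S.det ^ (-(1 : ℝ) / 2) with hC
  have hCpos : 0 < C := by
    have := hS_pd.det_pos
    positivity
  clear_value C
  generalize S⁻¹ = Q at *
  obtain ⟨ε, hε, hco⟩ := aux_coercive Q hQ
  -- total mass of ρ
  have hρint : Integrable (fun p : ℝ × ℝ × (Fin m → ℝ) => ρ p.1 p.2.1 p.2.2) := by
    have h := ((aux_ibp Q hQs hQ μ 0 0 0).1.const_mul C)
    have h' := (mp.integrable_comp_emb emb).2 h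
    refine h'.congr (Filter.Eventually.of_forall fun p => ?_)
    simp only [hρ, Function.comp]
  have hρtot : ∫ p : ℝ × ℝ × (Fin m → ℝ), ρ p.1 p.2.1 p.2.2 = 1 := by
    rw [← htot, ← mp.integral_comp emb]
    simp only [hρ]
  -- slices
  have hslice : ∀ x1, Integrable (fun q : ℝ × (Fin m → ℝ) => ρ x1 q.1 q.2) := by
    intro x1
    have hH : (volume : Measure (ℝ × (Fin m → ℝ))).IsAddHaarMeasure := by
      rw [Measure.volume_eq_prod]; infer_instance
    refine aux_integrable volume _ ?_ (μ 1, fun j => μ j.succ.succ) C (ε / 2) (by positivity) fun q => ?_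
    · simp only [hρ]; fun_prop
    rw [hρ, abs_mul, Real.abs_exp, abs_of_pos hCpos]
    refine mul_le_mul_of_nonneg_left ?_ hCpos.le
    have hn : ‖q - (μ 1, fun j => μ j.succ.succ)‖ ≤ ‖e (x1, q.1, q.2) - μ‖ := by
      rw [Prod.norm_def]
      refine max_le ?_ ?_
      · have := norm_le_pi_norm (e (x1, q.1, q.2) - μ) 1
        simpa [e1] using this
      · refine (pi_norm_le_iff_of_nonneg (norm_nonneg _)).2 fun j => ?_
        have := norm_le_pi_norm (e (x1, q.1, q.2) - μ) j.succ.succ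
        simpa [e2] using this
    set T := ‖q - (μ 1, fun j => μ j.succ.succ)‖
    have hT : 0 ≤ T := norm_nonneg _
    have hTT : T ^ 2 ≤ ‖e (x1, q.1, q.2) - μ‖ ^ 2 := by gcongr
    have := hco (e (x1, q.1, q.2) - μ)
    calc _ ≤ 1 * Real.exp (-(ε / 2 * T ^ 2)) := by
          rw [one_mul, Real.exp_le_exp]; nlinarith
      _ ≤ _ := by
          gcongr
          nlinarith
  -- the ρ12 marginal
  set c2 : ℝ := ∫ v : Fin m → ℝ, Real.exp (-(1 / 2) * (e (0, 0, v) ⬝ᵥ (Q *ᵥ e (0, 0, v)))) with hc2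
  have hc2pos : 0 < c2 := by
    apply integral_exp_pos
    refine aux_integrable volume _ (by fun_prop) 0 1 (ε / 2) (by positivity) fun v => ?_
    rw [Real.abs_exp, sub_zero, one_mul]
    have hn : ‖v‖ ≤ ‖e (0, 0, v)‖ := by
      refine (pi_norm_le_iff_of_nonneg (norm_nonneg _)).2 fun j => ?_
      have := norm_le_pi_norm (e (0, 0, v)) j.succ.succ
      simpa [e2] using this
    have hT : 0 ≤ ‖v‖ := norm_nonneg _
    have hTT : ‖v‖ ^ 2 ≤ ‖e (0, 0, v)‖ ^ 2 := by gcongr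
    have := hco (e (0, 0, v))
    calc _ ≤ 1 * Real.exp (-(ε / 2 * ‖v‖ ^ 2)) := by
          rw [one_mul, Real.exp_le_exp]; nlinarith
      _ ≤ _ := by
          gcongr
          nlinarith
  have hρ12' : ∀ x1 x2, ρ12 x1 x2 = C * c2 * Real.exp (-(1 / 2) * ((x1 - μ 0) ^ 2 / S 0 0)) *
      Real.exp (-(1 / 2) * β * ((x2 - μ 1) - k * (x1 - μ 0)) ^ 2) := by
    intro x1 x2
    obtain ⟨p, hp0, hp1, hp⟩ := h12 (x1 - μ 0) (x2 - μ 1)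
    have hy : ∀ y, ρ x1 x2 y = (C * Real.exp (-(1 / 2) * ((x1 - μ 0) ^ 2 / S 0 0)) *
        Real.exp (-(1 / 2) * β * ((x2 - μ 1) - k * (x1 - μ 0)) ^ 2)) *
        Real.exp (-(1 / 2) * (e (0, 0, y - fun j => (μ + p) j.succ.succ) ⬝ᵥ
          (Q *ᵥ e (0, 0, y - fun j => (μ + p) j.succ.succ)))) := by
      intro y
      rw [hρ, hp (e (x1, x2, y) - μ) (by simp [e0]) (by simp [e1])]
      have : e (x1, x2, y) - μ - p = e (0, 0, y - fun j => (μ + p) j.succ.succ) := by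
        ext i
        refine Fin.cases ?_ (fun i => Fin.cases ?_ (fun j => ?_) i) i
        · simp [e0, hp0]
        · simp [e1, hp1]
        · simp only [Pi.sub_apply, e2, Pi.add_apply]; ring
      rw [this, mul_assoc, mul_assoc, ← Real.exp_add, ← Real.exp_add]
      congr 2
      ring
    rw [hρ12]
    simp only [hy]
    rw [integral_const_mul, integral_sub_right_eq_self (fun v : Fin m → ℝ =>
      Real.exp (-(1 / 2) * (e (0, 0, v) ⬝ᵥ (Q *ᵥ e (0, 0, v)))))]
    ring
  set G : ℝ := ∫ s : ℝ, Real.exp (-(1 / 2 * β) * s ^ 2) with hG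
  have hGpos : 0 < G := by rw [hG, integral_gaussian]; positivity
  have hGs : ∀ x1, ∫ x2 : ℝ, Real.exp (-(1 / 2) * β * ((x2 - μ 1) - k * (x1 - μ 0)) ^ 2) = G := by
    intro x1
    rw [hG, ← integral_sub_right_eq_self (fun s : ℝ => Real.exp (-(1 / 2 * β) * s ^ 2)) (μ 1 + k * (x1 - μ 0))]
    congr 1; ext x; congr 1; ring
  have hρ1' : ∀ x1, ρ1 x1 = C * c2 * Real.exp (-(1 / 2) * ((x1 - μ 0) ^ 2 / S 0 0)) * G := by
    intro x1
    rw [hρ1]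
    have := integral_prod _ (hslice x1)
    rw [← Measure.volume_eq_prod] at this
    rw [this]
    simp only [← hρ12, hρ12']
    rw [integral_const_mul, hGs]
  have hr : ∀ x1 x2, ρ12 x1 x2 / ρ1 x1 =
      G⁻¹ * Real.exp (-(1 / 2) * β * ((x2 - μ 1) - k * (x1 - μ 0)) ^ 2) := by
    intro x1 x2
    rw [hρ12', hρ1']
    field_simp
  have hrint : ∀ x1, ∫ x2, ρ12 x1 x2 / ρ1 x1 = 1 := by
    intro x1
    simp only [hr]
    rw [integral_const_mul, hGs, inv_mul_cancel₀ hGpos.ne']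
  -- the ρm2 marginal
  set H : ℝ := ∫ s : ℝ, Real.exp (-(1 / 2 * Q 1 1) * s ^ 2) with hH
  have hM1' : ∀ w, (Pi.single 1 1 : Fin (m + 2) → ℝ) ⬝ᵥ (M *ᵥ w) = 0 := fun w => by
    rw [dotProduct_mulVec, ← mulVec_transpose, hMs.eq, hM1, zero_dotProduct]
  have hρm : ∀ x1 x2 y, ρm2 x1 y = C * H *
      Real.exp (-(1 / 2) * ((e (x1, x2, y) - μ) ⬝ᵥ (M *ᵥ (e (x1, x2, y) - μ)))) := by
    intro x1 x2' y
    set w := e (x1, x2', y) - μ with hw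
    have hx : ∀ x2, ρ x1 x2 y = C * Real.exp (-(1 / 2) * (w ⬝ᵥ (M *ᵥ w))) *
        Real.exp (-(1 / 2 * Q 1 1) * (x2 - (x2' - Q 1 ⬝ᵥ w / Q 1 1)) ^ 2) := by
      intro x2
      have : e (x1, x2, y) - μ = w + (x2 - x2') • Pi.single 1 1 := by
        ext i
        refine Fin.cases ?_ (fun i => Fin.cases ?_ (fun j => ?_) i) i
        · simp [e0, hw]
        · simp [e1, hw]
        · have : (j.succ.succ : Fin (m + 2)) ≠ 1 := by
            intro h; simp [Fin.ext_iff] at h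
          simp [e2, hw, this]
      rw [hρ, this, hMq, mulVec_add, mulVec_smul, hM1, smul_zero, add_zero, add_dotProduct,
        smul_dotProduct, hM1', smul_zero, add_zero, mul_assoc, ← Real.exp_add]
      congr 2
      simp [dotProduct_add]
      field_simp
      ring
    rw [hρm2]
    simp only [hx]
    rw [integral_const_mul, integral_sub_right_eq_self (fun s : ℝ => Real.exp (-(1 / 2 * Q 1 1) * s ^ 2))]
    ring
  -- the combined form
  set v : Fin (m + 2) → ℝ := Pi.single 1 1 - k • Pi.single 0 1 with hv
  set D : Fin (m + 2) → ℝ := Pi.single 0 1 + k • Pi.single 1 1 with hD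
  set A : Matrix (Fin (m + 2)) (Fin (m + 2)) ℝ := M + β • vecMulVec v v with hA
  have hvw : ∀ w, v ⬝ᵥ w = w 1 - k * w 0 := fun w => by simp [hv, sub_dotProduct]
  have hAw : ∀ w, A *ᵥ w = M *ᵥ w + (β * (w 1 - k * w 0)) • v := by
    intro w
    rw [hA, add_mulVec, smul_mulVec, vecMulVec_mulVec, hvw]
    ext i; simp; ring
  have hAq : ∀ w, w ⬝ᵥ (A *ᵥ w) = w ⬝ᵥ (M *ᵥ w) + β * (w 1 - k * w 0) ^ 2 := by
    intro w
    rw [hAw, dotProduct_add, dotProduct_smul, dotProduct_comm w v, hvw, smul_eq_mul]; ring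
  have hApd : ∀ w, w ≠ 0 → 0 < w ⬝ᵥ (A *ᵥ w) := fun w hw => by rw [hAq]; exact hMpd w hw
  have hAs : A.IsSymm := by
    have h : (vecMulVec v v).IsSymm := by
      ext i j; simp [vecMulVec_apply, mul_comm]
    exact hMs.add (h.smul β)
  have hDA : ∀ w, D ⬝ᵥ (A *ᵥ w) = (Pi.single 0 1 : Fin (m + 2) → ℝ) ⬝ᵥ (M *ᵥ w) := by
    intro w
    have hvD : D ⬝ᵥ v = 0 := by rw [dotProduct_comm, hvw]; simp [hD]
    rw [hAw, dotProduct_add, dotProduct_smul, hvD, smul_zero, add_zero, hD, add_dotProduct,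
      smul_dotProduct, hM1', smul_zero, add_zero]
  have hrρ : ∀ x1 x2 y, ρ12 x1 x2 / ρ1 x1 * ρm2 x1 y = (G⁻¹ * (C * H)) *
      Real.exp (-(1 / 2) * ((e (x1, x2, y) - μ) ⬝ᵥ (A *ᵥ (e (x1, x2, y) - μ)))) := by
    intro x1 x2 y
    rw [hr, hρm x1 x2 y, hAq]
    have : -(1 / 2) * ((e (x1, x2, y) - μ) ⬝ᵥ M *ᵥ (e (x1, x2, y) - μ) +
        β * ((e (x1, x2, y) - μ) 1 - k * (e (x1, x2, y) - μ) 0) ^ 2) =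
        -(1 / 2) * β * (x2 - μ 1 - k * (x1 - μ 0)) ^ 2 +
        -(1 / 2) * ((e (x1, x2, y) - μ) ⬝ᵥ M *ᵥ (e (x1, x2, y) - μ)) := by
      simp only [Pi.sub_apply, e0, e1]; ring
    rw [this, Real.exp_add]
    ring
  set K : ℝ := G⁻¹ * (C * H) with hK
  have hAint := (aux_ibp A hAs hApd μ 0 0 0).1
  have hmass : ∫ x, K * Real.exp (-(1 / 2) * ((x - μ) ⬝ᵥ (A *ᵥ (x - μ)))) = 1 := by
    have hi := (mp.integrable_comp_emb emb).2 (hAint.const_mul K)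
    have hi' : Integrable (fun p : ℝ × ℝ × (Fin m → ℝ) => ρ12 p.1 p.2.1 / ρ1 p.1 * ρm2 p.1 p.2.2) := by
      refine hi.congr (Filter.Eventually.of_forall fun p => ?_)
      simp only [hrρ, Function.comp]
    rw [← mp.integral_comp emb]
    have : ∀ p : ℝ × ℝ × (Fin m → ℝ), K * Real.exp (-(1 / 2) * ((e p - μ) ⬝ᵥ (A *ᵥ (e p - μ)))) =
      ρ12 p.1 p.2.1 / ρ1 p.1 * ρm2 p.1 p.2.2 := fun p => by rw [hrρ]
    simp only [this]
    have f1 := integral_prod _ hi'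
    have f2 := integral_prod _ hρint
    rw [← Measure.volume_eq_prod] at f1 f2
    rw [f1, ← hρtot, f2]
    congr 1; ext x1
    have f3 := integral_prod_mul (μ := (volume : Measure ℝ)) (ν := (volume : Measure (Fin m → ℝ)))
      (fun x2 => ρ12 x1 x2 / ρ1 x1) (fun y => ρm2 x1 y)
    have f4 := integral_prod_symm _ (hslice x1)
    rw [← Measure.volume_eq_prod] at f3 f4
    rw [f3, f4, hrint, one_mul]
    simp only [hρm2]
  -- derivatives
  have het : ∀ t x2 y, e (t, x2, y) - μ = (e (0, x2, y) - μ) + t • Pi.single 0 1 := by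
    intro t x2 y
    ext i
    refine Fin.cases ?_ (fun i => Fin.cases ?_ (fun j => ?_) i) i
    · simp [e0]; ring
    · simp [e1]
    · simp [e2]
  have hd : ∀ x1 x2 y, HasDerivAt (fun t => ρm2 t y)
      (-((Pi.single 0 1 : Fin (m + 2) → ℝ) ⬝ᵥ (M *ᵥ (e (x1, x2, y) - μ))) * ρm2 x1 y) x1 := by
    intro x1 x2 y
    have hf : (fun t => ρm2 t y) = fun t => C * H * Real.exp (-(1 / 2) *
        (((e (0, x2, y) - μ) + t • Pi.single 0 1) ⬝ᵥ (M *ᵥ ((e (0, x2, y) - μ) + t • Pi.single 0 1)))) := by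
      ext t; rw [hρm t x2 y, het t x2 y]
    rw [hf, hρm x1 x2 y, het x1 x2 y]
    refine ((aux_deriv M hMs (e (0, x2, y) - μ) (Pi.single 0 1) x1).const_mul (C * H)).congr_deriv ?_
    ring
  have hF : ∀ x1 x2 y, HasDerivAt (fun t => F1 t x2 y) (a 0) x1 := by
    intro x1 x2 y
    have : (fun t => F1 t x2 y) = fun t => (F1 0 x2 y) + t * a 0 := by
      ext t
      rw [hF1, hF1, Fin.sum_univ_succ, Fin.sum_univ_succ (fun i => a i * e (0, x2, y) i), e0, e0]
      have : ∀ i : Fin (m + 1), e (t, x2, y) i.succ = e (0, x2, y) i.succ := fun i => by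
        rw [he, he]; rfl
      simp only [this]
      ring
    rw [this]
    simpa using ((hasDerivAt_id x1).mul_const (a 0)).const_add (F1 0 x2 y)
  have hd2 : ∀ x1 x2 y, HasDerivAt (deriv (fun t => g11 * ρm2 t y))
      (g11 * (((Pi.single 0 1 : Fin (m + 2) → ℝ) ⬝ᵥ (M *ᵥ (e (x1, x2, y) - μ))) ^ 2 - M 0 0) * ρm2 x1 y) x1 := by
    intro x1 x2 y
    have : deriv (fun t => g11 * ρm2 t y) = fun t =>
        g11 * (-(((Pi.single 0 1 : Fin (m + 2) → ℝ) ⬝ᵥ (M *ᵥ (e (0, x2, y) - μ))) + t * M 0 0) * ρm2 t y) := by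
      ext t
      rw [((hd t x2 y).const_mul g11).deriv, het t x2 y, mulVec_add, mulVec_smul, dotProduct_add, dotProduct_smul]
      simp
    rw [this]
    have h := ((((((hasDerivAt_id x1).mul_const (M 0 0)).const_add
      ((Pi.single 0 1 : Fin (m + 2) → ℝ) ⬝ᵥ (M *ᵥ (e (0, x2, y) - μ)))).neg).mul (hd x1 x2 y)).const_mul g11)
    refine h.congr_deriv ?_
    rw [het x1 x2 y, mulVec_add, mulVec_smul, dotProduct_add, dotProduct_smul]
    simp
    ring
  have hsD : a ⬝ᵥ D = a 0 + k * a 1 := by simp [hD, dotProduct_add]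
  obtain ⟨-, j1, j2⟩ := aux_ibp A hAs hApd μ D a f1
  obtain ⟨-, -, j3⟩ := aux_ibp A hAs hApd μ D (A *ᵥ D) (-((A *ᵥ D) ⬝ᵥ μ))
  have hADw : ∀ w, (A *ᵥ D) ⬝ᵥ w = D ⬝ᵥ (A *ᵥ w) := fun w => by
    rw [dotProduct_mulVec, ← mulVec_transpose, hAs.eq]
  have I1 : ∫ q : ℝ × ℝ × (Fin m → ℝ),
        ρ12 q.1 q.2.1 / ρ1 q.1 * deriv (fun t => F1 t q.2.1 q.2.2 * ρm2 t q.2.2) q.1 = -(k * a 1) := by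
    have h : ∀ q : ℝ × ℝ × (Fin m → ℝ),
        ρ12 q.1 q.2.1 / ρ1 q.1 * deriv (fun t => F1 t q.2.1 q.2.2 * ρm2 t q.2.2) q.1 =
        (fun x => K * ((a ⬝ᵥ D - (f1 + a ⬝ᵥ x) * (D ⬝ᵥ A *ᵥ (x - μ))) *
          Real.exp (-(1 / 2) * ((x - μ) ⬝ᵥ (A *ᵥ (x - μ))))) -
          (k * a 1) * (K * Real.exp (-(1 / 2) * ((x - μ) ⬝ᵥ (A *ᵥ (x - μ)))))) (e q) := by
      rintro ⟨x1, x2, y⟩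
      have hF' : F1 x1 x2 y = f1 + a ⬝ᵥ e (x1, x2, y) := hF1 x1 x2 y
      have := ((hF x1 x2 y).mul (hd x1 x2 y)).deriv
      simp only [Pi.mul_def] at this
      simp only [this, hDA, hsD]
      have h3 := hrρ x1 x2 y
      rw [← hF']
      linear_combination (a 0 - F1 x1 x2 y * ((Pi.single 0 1 : Fin (m + 2) → ℝ) ⬝ᵥ (M *ᵥ (e (x1, x2, y) - μ)))) * h3
    refine (integral_congr_ae (Filter.Eventually.of_forall h)).trans ((mp.integral_comp emb (fun x => K * ((a ⬝ᵥ D - (f1 + a ⬝ᵥ x) * (D ⬝ᵥ A *ᵥ (x - μ))) *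
          Real.exp (-(1 / 2) * ((x - μ) ⬝ᵥ (A *ᵥ (x - μ))))) -
          (k * a 1) * (K * Real.exp (-(1 / 2) * ((x - μ) ⬝ᵥ (A *ᵥ (x - μ))))))).trans ?_)
    rw [integral_sub (j1.const_mul K) ((hAint.const_mul K).const_mul _), integral_const_mul, j2,
      integral_const_mul, hmass]
    ring
  have I2 : ∫ q : ℝ × ℝ × (Fin m → ℝ),
        ρ12 q.1 q.2.1 / ρ1 q.1 * deriv (deriv (fun t => g11 * ρm2 t q.2.2)) q.1 = 0 := by
    have h : ∀ q : ℝ × ℝ × (Fin m → ℝ),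
        ρ12 q.1 q.2.1 / ρ1 q.1 * deriv (deriv (fun t => g11 * ρm2 t q.2.2)) q.1 =
        (fun x => (-g11 * K) * (((A *ᵥ D) ⬝ᵥ D - (-((A *ᵥ D) ⬝ᵥ μ) + (A *ᵥ D) ⬝ᵥ x) * (D ⬝ᵥ A *ᵥ (x - μ))) *
          Real.exp (-(1 / 2) * ((x - μ) ⬝ᵥ (A *ᵥ (x - μ)))))) (e q) := by
      rintro ⟨x1, x2, y⟩
      have h3 := hrρ x1 x2 y
      have h4 : -((A *ᵥ D) ⬝ᵥ μ) + (A *ᵥ D) ⬝ᵥ e (x1, x2, y) =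
          (Pi.single 0 1 : Fin (m + 2) → ℝ) ⬝ᵥ (M *ᵥ (e (x1, x2, y) - μ)) := by
        rw [← hDA, ← hADw, dotProduct_sub]; ring
      have h5 : (A *ᵥ D) ⬝ᵥ D = M 0 0 := by
        rw [hADw, hDA, hD, mulVec_add, mulVec_smul, hM1]; simp
      simp only [(hd2 x1 x2 y).deriv, h4, h5, hDA]
      linear_combination g11 * (((Pi.single 0 1 : Fin (m + 2) → ℝ) ⬝ᵥ (M *ᵥ (e (x1, x2, y) - μ))) ^ 2 - M 0 0) * h3
    refine (integral_congr_ae (Filter.Eventually.of_forall h)).trans ((mp.integral_comp emb (fun x => (-g11 * K) * (((A *ᵥ D) ⬝ᵥ D - (-((A *ᵥ D) ⬝ᵥ μ) + (A *ᵥ D) ⬝ᵥ x) * (D ⬝ᵥ A *ᵥ (x - μ))) *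
          Real.exp (-(1 / 2) * ((x - μ) ⬝ᵥ (A *ᵥ (x - μ))))))).trans ?_)
    rw [integral_const_mul, j3, mul_zero]
  rw [I1, I2, hk]
  ring
end
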